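/- Assume in addition that m is a prime with m ≡ 3 (mod 4), that χ is not quadratic (i.e. χ² is nontrivial), and that χ(−1) = −φ(−1). Let χ_m be the quadratic character modulo m (the Legendre symbol), and define Λ_±(E_{φ,M,L}, χ, 1) := (1/2)·[Λ(E_{φ,M,L}, χ, 1) ± Λ(E_{φ,M,L}, χχ_m, 1)]. Then for both choices of sign, Λ_±(E_{φ,M,L}, χ, 1) = (φ(−m)·τ(φ)/f)·χ(f·D)·(∏_{l ∣ T₁}(1 − χ(l)φ(l)/l))·(∏_{q ∣ T₂}(1 − χ(q)φ⁻¹(q)))·(B₁(χ⁻¹φ⁻¹)/2)·(B₁(χφ⁻¹)/2). -/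

import Mathlib

open scoped BigOperators Real

/-- The Gauss sum `τ(ψ) = Σ_{a=0}^{c−1} ψ(a)·e^{2πia/c}` of a Dirichlet character mod `c`. -/
noncomputable def gaussSum' (c : ℕ) (ψ : DirichletCharacter ℂ c) : ℂ :=
  ∑ a ∈ Finset.range c, ψ ((a : ℕ) : ZMod c) * Complex.exp (2 * (π : ℂ) * Complex.I * a / c)

/-- The first generalized Bernoulli number `B₁(ψ) = (1/c)·Σ_{a=0}^{c−1} ψ(a)·a`. -/
noncomputable def B1 (c : ℕ) (ψ : DirichletCharacter ℂ c) : ℂ :=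
  (1 / (c : ℂ)) * ∑ a ∈ Finset.range c, ψ ((a : ℕ) : ZMod c) * (a : ℂ)

/-- The product character `χ·φ` modulo `f·m` of Dirichlet characters `χ` mod `m` and
`φ` mod `f`. -/
noncomputable def prodChar (m f : ℕ) (χ : DirichletCharacter ℂ m)
    (φ : DirichletCharacter ℂ f) : DirichletCharacter ℂ (f * m) :=
  (DirichletCharacter.changeLevel (dvd_mul_left m f) χ) *
    (DirichletCharacter.changeLevel (dvd_mul_right f m) φ)

/-- The value at `s = 1` of the analytic continuation of the `ψ`-twisted `L`-function of
`E_{φ,M,L}`: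
`Λ(E_{φ,M,L}, ψ, 1) = (τ(ψ⁻¹)/(2πi))·ψ(D)·∏_{l∣T₁}(1 − ψφ(l)/l)·∏_{q∣T₂}(1 − ψφ⁻¹(q))
·L(ψφ, 1)·L(ψφ⁻¹, 0)`. -/
noncomputable def LambdaVal (f m : ℕ) [NeZero f] [NeZero m] (φ : DirichletCharacter ℂ f)
    (χ : DirichletCharacter ℂ m) (T₁ T₂ D : ℕ) : ℂ :=
  (gaussSum' m χ⁻¹ / (2 * (π : ℂ) * Complex.I)) * χ ((D : ℕ) : ZMod m) *
    (∏ l ∈ T₁.primeFactors,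
      (1 - χ ((l : ℕ) : ZMod m) * φ ((l : ℕ) : ZMod f) / (l : ℂ))) *
    (∏ q ∈ T₂.primeFactors,
      (1 - χ ((q : ℕ) : ZMod m) * φ⁻¹ ((q : ℕ) : ZMod f))) *
    (prodChar m f χ φ).LFunction 1 * (prodChar m f χ φ⁻¹).LFunction 0



lemma aux_term_bound (n : ℕ) (x : ℝ) (hx : 0 < x) (hx1 : x ≤ 1) (s : ℂ) (ε : ℝ)
    (hε : 0 < ε) (hs : ε < s.re) (hs3 : ‖s‖ < 3) (hn : 1 ≤ n) :
    ‖1 / ((n : ℂ) + (x : ℂ)) ^ s - 1 / ((n : ℂ) + ((1 : ℝ) : ℂ)) ^ s‖ ≤ 3 * (1 / (n : ℝ) ^ (1 + ε)) := by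
  have hn' : (1 : ℝ) ≤ n := by exact_mod_cast hn
  have key : ∀ u ∈ Set.Icc x 1, HasDerivWithinAt (fun u : ℝ => ((n : ℂ) + (u : ℂ)) ^ (-s))
      (-s * ((n : ℂ) + (u : ℂ)) ^ (-s - 1)) (Set.Icc x 1) u := by
    intro u hu
    have h1 : HasDerivAt (fun z : ℂ => ((n : ℂ) + z) ^ (-s))
        (-s * ((n : ℂ) + (u : ℂ)) ^ (-s - 1) * 1) (u : ℂ) := by
      apply HasDerivAt.cpow_const ((hasDerivAt_id (u : ℂ)).const_add _)
      left
      simp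
      linarith [hu.1]
    simpa using h1.comp_ofReal.hasDerivWithinAt
  have bd : ∀ u ∈ Set.Icc x 1, ‖-s * ((n : ℂ) + (u : ℂ)) ^ (-s - 1)‖ ≤ 3 * (1 / (n : ℝ) ^ (1 + ε)) := by
    intro u hu
    have hu0 : 0 < u := hx.trans_le hu.1
    have e : ((n : ℂ) + (u : ℂ)) = (((n : ℝ) + u : ℝ) : ℂ) := by push_cast; rfl
    rw [norm_mul, norm_neg, e, Complex.norm_cpow_eq_rpow_re_of_pos (by linarith)]
    apply mul_le_mul hs3.le _ (by positivity) (by norm_num)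
    rw [one_div, ← Real.rpow_neg (by linarith)]
    calc ((n : ℝ) + u) ^ (-s - 1).re ≤ ((n : ℝ) + u) ^ (-(1 + ε)) := by
          apply Real.rpow_le_rpow_of_exponent_le (by linarith)
          simp; linarith
      _ ≤ _ := by
          apply Real.rpow_le_rpow_of_nonpos (by linarith) (by linarith) (by linarith)
  have := Convex.norm_image_sub_le_of_norm_hasDerivWithin_le key bd (convex_Icc x 1)
    (Set.right_mem_Icc.2 hx1) (Set.left_mem_Icc.2 hx1)
  simp only [Complex.cpow_neg, ← one_div] at this
  refine this.trans ?_
  have h2 : ‖x - 1‖ ≤ 1 := by rw [Real.norm_eq_abs, abs_le]; constructor <;> linarith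
  have h3 : 0 ≤ 3 * (1 / (n : ℝ) ^ (1 + ε)) := by positivity
  nlinarith

lemma aux_real_term (n : ℕ) (x : ℝ) (hx : 0 < x) (hx1 : x ≤ 1) (s : ℝ) (hs : 0 < s) :
    s * (1 - x) * (1 / ((n : ℝ) + 1) ^ (s + 1)) ≤ 1 / ((n : ℝ) + x) ^ s - 1 / ((n : ℝ) + 1) ^ s ∧
    (1 ≤ n → 1 / ((n : ℝ) + x) ^ s - 1 / ((n : ℝ) + 1) ^ s ≤ s * (1 - x) * (1 / (n : ℝ) ^ (s + 1))) := by
  rcases hx1.eq_or_lt with rfl | hx1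
  · simp
  have hn0 : (0 : ℝ) ≤ n := Nat.cast_nonneg n
  obtain ⟨c, hc, hc'⟩ := exists_hasDerivAt_eq_slope (fun u : ℝ => ((n : ℝ) + u) ^ (-s))
    (fun u => -s * ((n : ℝ) + u) ^ (-s - 1)) hx1
    (by
      apply ContinuousOn.rpow_const (by fun_prop)
      intro u hu; left; linarith [hu.1])
    (by
      intro u hu
      have := ((hasDerivAt_id u).const_add (n : ℝ)).rpow_const (p := -s) (Or.inl (by simp; linarith [hu.1]))
      simpa using this)
  rw [eq_div_iff (by linarith)] at hc'
  have e : 1 / ((n : ℝ) + x) ^ s - 1 / ((n : ℝ) + 1) ^ s = s * (1 - x) * ((n : ℝ) + c) ^ (-(s + 1)) := by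
    rw [one_div, one_div, ← Real.rpow_neg (by linarith), ← Real.rpow_neg (by linarith),
      show -(s+1) = -s - 1 by ring]
    linarith
  rw [e]
  have hc0 : 0 < c := hx.trans hc.1
  have hp : 0 ≤ s * (1 - x) := mul_nonneg hs.le (by linarith)
  constructor
  · apply mul_le_mul_of_nonneg_left _ hp
    rw [one_div, ← Real.rpow_neg (by linarith)]
    exact Real.rpow_le_rpow_of_nonpos (by linarith) (by linarith [hc.2]) (by linarith)
  · intro hn
    have hn' : (1 : ℝ) ≤ n := by exact_mod_cast hn
    apply mul_le_mul_of_nonneg_left _ hp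
    rw [one_div, ← Real.rpow_neg (by linarith)]
    exact Real.rpow_le_rpow_of_nonpos (by linarith) (by linarith [hc.2]) (by linarith)

lemma aux_summable (ε : ℝ) (hε : 0 < ε) :
    Summable (fun n : ℕ => (1 / ((n + 1 : ℕ) : ℝ) ^ (1 + ε))) :=
  (summable_nat_add_iff 1).2 (Real.summable_one_div_nat_rpow.2 (by linarith))

lemma aux_cont (x : ℝ) (hx : 0 < x) (hx1 : x ≤ 1) (e : ℝ) (he : 0 < e) (he1 : e < 1) :
    HurwitzZeta.hurwitzZeta (x : UnitAddCircle) (e : ℂ) - riemannZeta (e : ℂ) =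
      (1 / (((0 : ℕ) : ℂ) + (x : ℂ)) ^ (e : ℂ) - 1 / (((0 : ℕ) : ℂ) + ((1 : ℝ) : ℂ)) ^ (e : ℂ)) +
      ∑' n : ℕ, (1 / (((n + 1 : ℕ) : ℂ) + (x : ℂ)) ^ (e : ℂ) -
        1 / (((n + 1 : ℕ) : ℂ) + ((1 : ℝ) : ℂ)) ^ (e : ℂ)) := by
  set t : ℕ → ℂ → ℂ := fun n s => 1 / ((n : ℂ) + (x : ℂ)) ^ s - 1 / ((n : ℂ) + ((1 : ℝ) : ℂ)) ^ s with ht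
  have htd : ∀ n, Differentiable ℂ (t n) := by
    intro n
    have h : ∀ y : ℝ, 0 < y → Differentiable ℂ (fun s : ℂ => 1 / ((n : ℂ) + (y : ℂ)) ^ s) := by
      intro y hy
      have h0 : ((n : ℂ) + (y : ℂ)) ≠ 0 := by
        have : (0 : ℝ) < n + y := by positivity
        exact_mod_cast this.ne'
      intro s
      refine DifferentiableAt.div (by fun_prop) ?_ ?_
      · exact differentiableAt_id.const_cpow (Or.inl h0)
      · simp [Complex.cpow_eq_zero_iff, h0]
    exact (h x hx).sub (h 1 one_pos)
  let V : Set ℂ := {s | e / 2 < s.re} ∩ Metric.ball 0 3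
  have hVo : IsOpen V := (isOpen_lt continuous_const Complex.continuous_re).inter Metric.isOpen_ball
  have hVc : Convex ℝ V := (convex_halfSpace_re_gt _).inter (convex_ball _ _)
  have hS : DifferentiableOn ℂ (fun s => ∑' n : ℕ, t (n + 1) s) V := by
    refine Complex.differentiableOn_tsum_of_summable_norm
      ((aux_summable (e / 2) (by linarith)).mul_left 3)
      (fun n => (htd _).differentiableOn) hVo ?_
    intro n s hs
    exact aux_term_bound (n + 1) x hx hx1 s (e / 2) (by linarith) hs.1 (by simpa using hs.2) (by omega)
  have hR : DifferentiableOn ℂ (fun s => t 0 s + ∑' n : ℕ, t (n + 1) s) V :=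
    ((htd 0).differentiableOn).add hS
  have hL : DifferentiableOn ℂ (fun s => HurwitzZeta.hurwitzZeta (x : UnitAddCircle) s
      - HurwitzZeta.hurwitzZeta ((1 : ℝ) : UnitAddCircle) s) V :=
    (HurwitzZeta.differentiable_hurwitzZeta_sub_hurwitzZeta _ _).differentiableOn
  have h2V : (2 : ℂ) ∈ V := by
    refine ⟨?_, ?_⟩
    · show e / 2 < (2 : ℂ).re
      simp; linarith
    · simp; norm_num
  have heV : (e : ℂ) ∈ V := by
    refine ⟨?_, ?_⟩
    · show e / 2 < (e : ℂ).re
      simp; linarith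
    · simp [abs_of_pos he]; linarith
  have key := (hL.analyticOnNhd hVo).eqOn_of_preconnected_of_eventuallyEq (hR.analyticOnNhd hVo)
    hVc.isPreconnected h2V (by
      have : {s : ℂ | 1 < s.re} ∈ nhds (2 : ℂ) :=
        (isOpen_lt continuous_const Complex.continuous_re).mem_nhds (by simp)
      filter_upwards [this] with s hs
      have h1 := HurwitzZeta.hasSum_hurwitzZeta_of_one_lt_re (a := x) ⟨hx.le, hx1⟩ hs
      have h2 := HurwitzZeta.hasSum_hurwitzZeta_of_one_lt_re (a := 1) ⟨zero_le_one, le_rfl⟩ hs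
      have h3 := h1.sub h2
      rw [← h3.tsum_eq, h3.summable.tsum_eq_zero_add])
  have := key heV
  simp only at this
  rw [← this, AddCircle.coe_period, HurwitzZeta.hurwitzZeta_zero]

open Filter Topology in
lemma aux_hz_zero (x : ℝ) (hx : 0 < x) (hx1 : x ≤ 1) :
    HurwitzZeta.hurwitzZeta (x : UnitAddCircle) 0 = 1 / 2 - (x : ℂ) := by
  set G : ℂ → ℂ := fun s => HurwitzZeta.hurwitzZeta (x : UnitAddCircle) s - riemannZeta s with hG
  have hGc : ContinuousAt G 0 :=
    (HurwitzZeta.differentiableAt_hurwitzZeta _ zero_ne_one).continuousAt.sub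
      (differentiableAt_riemannZeta zero_ne_one).continuousAt
  have hGl : Tendsto (fun e : ℝ => G (e : ℂ)) (𝓝[>] 0) (𝓝 (G 0)) := by
    have h0 : Tendsto (fun e : ℝ => (e : ℂ)) (𝓝[>] 0) (𝓝 0) := by
      have := (Complex.continuous_ofReal.tendsto 0).mono_left (nhdsWithin_le_nhds (s := Set.Ioi (0:ℝ)))
      simpa using this
    exact hGc.tendsto.comp h0
  set t : ℝ → ℕ → ℝ := fun s n => 1 / ((n : ℝ) + x) ^ s - 1 / ((n : ℝ) + 1) ^ s with ht
  set S : ℝ → ℝ := fun e => t e 0 + ∑' n : ℕ, t e (n + 1) with hS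
  set Z : ℝ → ℝ := fun e => ∑' n : ℕ, 1 / (n : ℝ) ^ (e + 1) with hZ
  have hGS : ∀ e : ℝ, 0 < e → e < 1 → G e = (S e : ℂ) := by
    intro e he he1
    have hc : ∀ (n : ℕ) (y : ℝ), 0 < y → (1 / ((n : ℂ) + (y : ℂ)) ^ (e : ℂ)) = ((1 / ((n : ℝ) + y) ^ e : ℝ) : ℂ) := by
      intro n y hy
      rw [Complex.ofReal_div, Complex.ofReal_cpow (by positivity)]
      push_cast; rfl
    simp only [hG, hS, ht]
    rw [aux_cont x hx hx1 e he he1]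
    simp only [hc _ x hx, hc _ 1 one_pos]
    push_cast
    rfl
  have hZs : ∀ e : ℝ, 0 < e → Summable (fun n : ℕ => 1 / (n : ℝ) ^ (e + 1)) := fun e he =>
    Real.summable_one_div_nat_rpow.2 (by linarith)
  have hZ1 : ∀ e : ℝ, 0 < e → Z e = ∑' n : ℕ, 1 / ((n + 1 : ℕ) : ℝ) ^ (e + 1) := by
    intro e he
    simp only [hZ]
    rw [(hZs e he).tsum_eq_zero_add]
    simp [Real.zero_rpow (by linarith : e + 1 ≠ 0)]
  have hZl : Tendsto (fun e => e * Z e) (𝓝[>] 0) (𝓝 1) := by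
    have h0 : Tendsto (fun e : ℝ => e + 1) (𝓝[>] 0) (𝓝[>] 1) := by
      apply tendsto_nhdsWithin_iff.2 ⟨?_, ?_⟩
      · have : Tendsto (fun e : ℝ => e + 1) (𝓝 0) (𝓝 (0 + 1)) := (continuous_id.add continuous_const).tendsto 0
        simpa using this.mono_left nhdsWithin_le_nhds
      · filter_upwards [self_mem_nhdsWithin] with e he
        simpa using he
    have := tendsto_sub_mul_tsum_nat_rpow.comp h0
    simpa [Function.comp_def, hZ] using this
  have ht0 : Tendsto (fun e => t e 0) (𝓝[>] 0) (𝓝 0) := by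
    have : ContinuousAt (fun e => t e 0) 0 := by
      simp only [ht]
      refine ContinuousAt.sub (ContinuousAt.div continuousAt_const ?_ ?_) (ContinuousAt.div continuousAt_const ?_ ?_)
      · exact ContinuousAt.rpow continuousAt_const continuousAt_id (Or.inl (by simp; linarith))
      · simp
      · exact ContinuousAt.rpow continuousAt_const continuousAt_id (Or.inl (by simp))
      · simp
    have h := this.tendsto.mono_left (nhdsWithin_le_nhds (s := Set.Ioi (0:ℝ)))
    simpa [ht] using h
  have hSum : ∀ e : ℝ, 0 < e → Summable (fun n : ℕ => t e (n + 1)) := by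
    intro e he
    refine Summable.of_nonneg_of_le (fun n => ?_) (fun n => (aux_real_term (n + 1) x hx hx1 e he).2 (by omega))
      (((summable_nat_add_iff 1).2 (hZs e he)).mul_left _)
    refine le_trans ?_ (aux_real_term (n + 1) x hx hx1 e he).1
    have : 0 ≤ 1 - x := by linarith
    positivity
  have hSl : Tendsto S (𝓝[>] 0) (𝓝 (1 - x)) := by
    have hlo : Tendsto (fun e => (1 - x) * (e * Z e)) (𝓝[>] 0) (𝓝 (1 - x)) := by
      simpa using hZl.const_mul (1 - x)
    have hhi : Tendsto (fun e => t e 0 + (1 - x) * (e * Z e)) (𝓝[>] 0) (𝓝 (1 - x)) := by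
      simpa using ht0.add hlo
    refine tendsto_of_tendsto_of_tendsto_of_le_of_le' hlo hhi ?_ ?_
    · filter_upwards [self_mem_nhdsWithin] with e he
      have he : 0 < e := he
      have hs := (summable_nat_add_iff 1).1 (hSum e he)
      have : S e = ∑' n, t e n := by rw [hs.tsum_eq_zero_add]
      rw [this, hZ1 e he, ← mul_assoc, ← tsum_mul_left]
      refine Summable.tsum_le_tsum (fun n => ?_) (((summable_nat_add_iff 1).2 (hZs e he)).mul_left _) hs
      have := (aux_real_term n x hx hx1 e he).1
      push_cast
      linarith
    · filter_upwards [self_mem_nhdsWithin] with e he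
      have he : 0 < e := he
      simp only [hS]
      rw [hZ1 e he, ← mul_assoc, ← tsum_mul_left]
      gcongr
      · exact hSum e he
      · exact ((summable_nat_add_iff 1).2 (hZs e he)).mul_left _
      · rename_i n
        have := (aux_real_term (n + 1) x hx hx1 e he).2 (by omega)
        simp only [ht]
        linarith
  have hfin : G 0 = ((1 - x : ℝ) : ℂ) := by
    refine tendsto_nhds_unique hGl ?_
    have h1 : Tendsto (fun e : ℝ => ((S e : ℝ) : ℂ)) (𝓝[>] 0) (𝓝 ((1 - x : ℝ) : ℂ)) :=
      (Complex.continuous_ofReal.tendsto _).comp hSl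
    refine h1.congr' ?_
    filter_upwards [Ioo_mem_nhdsGT (zero_lt_one' ℝ)] with e he
    exact (hGS e he.1 he.2).symm
  simp only [hG, riemannZeta_zero] at hfin
  push_cast at hfin
  linear_combination hfin

lemma aux_sum_range (c : ℕ) [NeZero c] (F : ZMod c → ℂ) :
    ∑ a ∈ Finset.range c, F ((a : ℕ) : ZMod c) = ∑ j : ZMod c, F j := by
  symm
  refine Finset.sum_bij' (fun j _ => j.val) (fun a _ => (a : ZMod c)) ?_ ?_ ?_ ?_ ?_
  · intro j _; simpa using ZMod.val_lt j
  · intro a _; simp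
  · intro j _; simp
  · intro a ha; exact ZMod.val_cast_of_lt (by simpa using ha)
  · intro j _; simp

lemma aux_gauss (c : ℕ) [NeZero c] (ψ : DirichletCharacter ℂ c) :
    gaussSum' c ψ = gaussSum ψ ZMod.stdAddChar := by
  rw [gaussSum, ← aux_sum_range, gaussSum']
  refine Finset.sum_congr rfl fun a _ => ?_
  rw [ZMod.stdAddChar_apply, ZMod.toCircle_natCast]

lemma aux_B1 (c : ℕ) [NeZero c] (ψ : DirichletCharacter ℂ c) :
    B1 c ψ = (1 / (c : ℂ)) * ∑ j : ZMod c, ψ j * (j.val : ℂ) := by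
  rw [B1, ← aux_sum_range]
  congr 1
  refine Finset.sum_congr rfl fun a ha => ?_
  rw [ZMod.val_cast_of_lt (by simpa using ha)]

lemma aux_L_zero (c : ℕ) [NeZero c] (hc : 1 < c) (ψ : DirichletCharacter ℂ c) (hψ : ψ.Odd) :
    ZMod.LFunction (fun j => ψ j) 0 = - B1 c ψ := by
  have hψ0 : ψ 0 = 0 := ψ.map_zero' (by omega)
  have hc0 : (c : ℂ) ≠ 0 := by exact_mod_cast (by omega : c ≠ 0)
  have hsum : ∑ j : ZMod c, ψ j = 0 := hψ.to_fun.sum_eq_zero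
  rw [ZMod.LFunction, aux_B1]
  have h : ∀ j : ZMod c, ψ j * HurwitzZeta.hurwitzZeta (ZMod.toAddCircle j) 0 =
      ψ j * (1 / 2) - (1 / (c : ℂ)) * (ψ j * (j.val : ℂ)) := by
    intro j
    rcases eq_or_ne j 0 with rfl | hj
    · simp [hψ0]
    · have hv : 0 < j.val := Nat.pos_of_ne_zero (by simpa [ZMod.val_eq_zero] using hj)
      have hcpos : (0 : ℝ) < c := by exact_mod_cast (by omega : 0 < c)
      rw [ZMod.toAddCircle_apply, aux_hz_zero]
      · push_cast; ring
      · have : (0 : ℝ) < j.val := by exact_mod_cast hv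
        positivity
      · rw [div_le_one hcpos]; exact_mod_cast (ZMod.val_lt j).le
  simp only [h, Finset.sum_sub_distrib, ← Finset.sum_mul, hsum, ← Finset.mul_sum]
  simp

lemma aux_prod_apply (m f : ℕ) [NeZero f] [NeZero m] (χ : DirichletCharacter ℂ m)
    (φ : DirichletCharacter ℂ f) (x : ZMod (f * m)) :
    prodChar m f χ φ x = χ (ZMod.castHom (dvd_mul_left m f) (ZMod m) x) *
      φ (ZMod.castHom (dvd_mul_right f m) (ZMod f) x) := by
  by_cases hx : IsUnit x
  · obtain ⟨u, rfl⟩ := hx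
    rw [prodChar, MulChar.mul_apply, DirichletCharacter.changeLevel_eq_cast_of_dvd,
      DirichletCharacter.changeLevel_eq_cast_of_dvd]
    rfl
  · rw [MulChar.map_nonunit _ hx]
    symm
    by_contra hne
    obtain ⟨h1, h2⟩ := mul_ne_zero_iff.1 hne
    apply hx
    have h1' : IsUnit (ZMod.castHom (dvd_mul_left m f) (ZMod m) x) := by
      by_contra h; exact h1 (MulChar.map_nonunit _ h)
    have h2' : IsUnit (ZMod.castHom (dvd_mul_right f m) (ZMod f) x) := by
      by_contra h; exact h2 (MulChar.map_nonunit _ h)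
    rw [← ZMod.natCast_zmod_val x] at h1' h2' ⊢
    rw [map_natCast, ZMod.isUnit_iff_coprime] at h1' h2'
    rw [ZMod.isUnit_iff_coprime]
    exact Nat.Coprime.mul_right h2' h1'

lemma aux_prod_inv (m f : ℕ) (χ : DirichletCharacter ℂ m)
    (φ : DirichletCharacter ℂ f) : (prodChar m f χ φ)⁻¹ = prodChar m f χ⁻¹ φ⁻¹ := by
  simp [prodChar, mul_comm]

lemma aux_std_mul (a b : ℕ) [NeZero a] [NeZero b] (j : ℤ) :
    ZMod.stdAddChar (((b * j : ℤ)) : ZMod (a * b)) = ZMod.stdAddChar (N := a) (j : ZMod a) := by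
  rw [ZMod.stdAddChar_coe, ZMod.stdAddChar_coe]
  congr 1
  have ha : (a : ℂ) ≠ 0 := NeZero.ne _
  have hb : (b : ℂ) ≠ 0 := NeZero.ne _
  push_cast
  field_simp

open ZMod in
lemma aux_dft (m f : ℕ) [NeZero f] [NeZero m] (hcop : Nat.Coprime f m) (χ : DirichletCharacter ℂ m)
    (φ : DirichletCharacter ℂ f) (hχ : χ.IsPrimitive) (hφ : φ.IsPrimitive) (k : ZMod (f * m)) :
    𝓕 (fun j => prodChar m f χ φ j) k = prodChar m f χ⁻¹ φ⁻¹ (-k) *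
      (χ (f : ZMod m) * φ (m : ZMod f) * gaussSum χ stdAddChar * gaussSum φ stdAddChar) := by
  obtain ⟨u, v, huv⟩ : IsCoprime (m : ℤ) (f : ℤ) := Nat.isCoprime_iff_coprime.2 hcop.symm
  -- u * m + v * f = 1
  have hum : (u : ZMod f) * (m : ZMod f) = 1 := by
    have := congrArg (fun z : ℤ => (z : ZMod f)) huv
    simpa using this
  have hvf : (v : ZMod m) * (f : ZMod m) = 1 := by
    have := congrArg (fun z : ℤ => (z : ZMod m)) huv
    simpa using this
  have hchar : ∀ y : ZMod (f * m), stdAddChar y =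
      stdAddChar ((u : ZMod f) * castHom (dvd_mul_right f m) (ZMod f) y) *
      stdAddChar ((v : ZMod m) * castHom (dvd_mul_left m f) (ZMod m) y) := by
    intro y
    obtain ⟨z, rfl⟩ := ZMod.intCast_surjective y
    have e1 := aux_std_mul f m (u * z)
    have e2 : ZMod.stdAddChar (((f * (v * z) : ℤ)) : ZMod (f * m)) = ZMod.stdAddChar (N := m) ((v * z : ℤ) : ZMod m) := by
      rw [ZMod.stdAddChar_coe, ZMod.stdAddChar_coe]
      congr 1
      have ha : (f : ℂ) ≠ 0 := NeZero.ne _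
      have hb : (m : ℂ) ≠ 0 := NeZero.ne _
      push_cast
      field_simp
    rw [map_intCast (castHom (dvd_mul_right f m) (ZMod f)), map_intCast (castHom (dvd_mul_left m f) (ZMod m)), ← Int.cast_mul, ← Int.cast_mul, ← e1, ← e2, ← AddChar.map_add_eq_mul]
    congr 1
    rw [← Int.cast_add]
    congr 1
    linear_combination (-z) * huv
  set kf := castHom (dvd_mul_right f m) (ZMod f) k with hkf
  set km := castHom (dvd_mul_left m f) (ZMod m) k with hkm
  have hstep : 𝓕 (fun j => prodChar m f χ φ j) k =
      𝓕 (fun j => φ j) ((u : ZMod f) * kf) * 𝓕 (fun j => χ j) ((v : ZMod m) * km) := by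
    rw [dft_apply, dft_apply, dft_apply, Finset.sum_mul_sum, ← Fintype.sum_prod_type']
    refine Fintype.sum_equiv (ZMod.chineseRemainder hcop).toEquiv _ _ fun j => ?_
    have c1 : ((ZMod.chineseRemainder hcop) j).1 = castHom (dvd_mul_right f m) (ZMod f) j :=
      RingHom.congr_fun (Subsingleton.elim ((RingHom.fst (ZMod f) (ZMod m)).comp (ZMod.chineseRemainder hcop).toRingHom) _) j
    have c2 : ((ZMod.chineseRemainder hcop) j).2 = castHom (dvd_mul_left m f) (ZMod m) j :=
      RingHom.congr_fun (Subsingleton.elim ((RingHom.snd (ZMod f) (ZMod m)).comp (ZMod.chineseRemainder hcop).toRingHom) _) j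
    simp only [RingEquiv.toEquiv_eq_coe, RingEquiv.coe_toEquiv, EquivLike.coe_coe, c1, c2, smul_eq_mul]
    rw [aux_prod_apply, hchar]
    simp only [map_neg, map_mul, ← hkf, ← hkm]
    ring_nf
  rw [hstep, hφ.fourierTransform_eq_inv_mul_gaussSum, hχ.fourierTransform_eq_inv_mul_gaussSum,
    aux_prod_apply]
  simp only [map_neg, ← hkf, ← hkm]
  have iu : φ⁻¹ (u : ZMod f) = φ (m : ZMod f) := by
    rw [MulChar.inv_apply_eq_inv']
    exact inv_eq_of_mul_eq_one_right (by rw [← map_mul, hum, map_one])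
  have iv : χ⁻¹ (v : ZMod m) = χ (f : ZMod m) := by
    rw [MulChar.inv_apply_eq_inv']
    exact inv_eq_of_mul_eq_one_right (by rw [← map_mul, hvf, map_one])
  rw [← mul_neg, ← mul_neg, map_mul, map_mul, iu, iv]
  ring

open ZMod in
lemma aux_gauss_mul (f : ℕ) [NeZero f] (φ : DirichletCharacter ℂ f) (hφ : φ.IsPrimitive) :
    gaussSum φ stdAddChar * (φ (-1) * gaussSum φ⁻¹ stdAddChar) = (f : ℂ) := by
  have h1 : 𝓕 (fun j => φ j) = fun k => gaussSum φ stdAddChar * φ⁻¹ (-k) := by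
    ext k
    rw [hφ.fourierTransform_eq_inv_mul_gaussSum, mul_comm]
  have h2 := congrFun (dft_dft (fun j => φ j)) (-1)
  have hinv : φ⁻¹ (-1) = φ (-1) := by
    rw [MulChar.inv_apply_eq_inv']
    refine inv_eq_of_mul_eq_one_right ?_
    rw [← map_mul]; simp
  rw [h1, dft_const_mul] at h2
  simp only [neg_neg, map_one, smul_eq_mul, mul_one] at h2
  rw [← h2, dft_comp_neg]
  simp only [neg_neg]
  rw [DirichletCharacter.fourierTransform_eq_gaussSum_mulShift]
  have := gaussSum_mulShift φ⁻¹ (stdAddChar (N := f)) (-1)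
  rw [Units.val_neg, Units.val_one, hinv] at this
  congr 1
  rw [← this, ← mul_assoc, ← map_mul]
  simp

open ZMod in
lemma aux_L_one (m f : ℕ) [NeZero f] [NeZero m] (hfm : 1 < f * m) (hcop : Nat.Coprime f m)
    (χ : DirichletCharacter ℂ m) (φ : DirichletCharacter ℂ f)
    (hχ : χ.IsPrimitive) (hφ : φ.IsPrimitive) (hodd : (prodChar m f χ⁻¹ φ⁻¹).Odd) :
    B1 (f * m) (prodChar m f χ⁻¹ φ⁻¹) = (Complex.I / π) *
      (χ⁻¹ (f : ZMod m) * φ⁻¹ (m : ZMod f) * gaussSum χ⁻¹ stdAddChar * gaussSum φ⁻¹ stdAddChar) *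
      (prodChar m f χ φ).LFunction 1 := by
  have hχ' : χ⁻¹.IsPrimitive := by
    rw [DirichletCharacter.isPrimitive_def, DirichletCharacter.conductor_inv]; exact hχ
  have hφ' : φ⁻¹.IsPrimitive := by
    rw [DirichletCharacter.isPrimitive_def, DirichletCharacter.conductor_inv]; exact hφ
  set θ := prodChar m f χ⁻¹ φ⁻¹ with hθ
  set C := χ⁻¹ (f : ZMod m) * φ⁻¹ (m : ZMod f) * gaussSum χ⁻¹ stdAddChar * gaussSum φ⁻¹ stdAddChar with hC
  have hodd' : (prodChar m f χ φ).Odd := by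
    have h : prodChar m f χ φ = θ⁻¹ := by rw [hθ, aux_prod_inv, inv_inv, inv_inv]
    have ho : θ (-1) = -1 := hodd
    rw [DirichletCharacter.Odd, h, MulChar.inv_apply_eq_inv', ho]
    norm_num
  have h0 := aux_L_zero (f * m) hfm θ hodd
  have h1 : 𝓕 (fun j => θ j) = fun k => (-C) * prodChar m f χ φ k := by
    ext k
    rw [hθ, aux_dft m f hcop _ _ hχ' hφ', inv_inv, inv_inv, hodd'.eval_neg]
    ring
  have h2 : 𝓕 (fun j => θ (-j)) = fun k => C * prodChar m f χ φ k := by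
    rw [dft_comp_neg, h1]
    ext k
    simp only [hodd'.eval_neg]
    ring
  have hlin : ∀ (c : ℂ), ZMod.LFunction (fun k => c * prodChar m f χ φ k) 1 =
      c * (prodChar m f χ φ).LFunction 1 := by
    intro c
    rw [DirichletCharacter.LFunction, ZMod.LFunction, ZMod.LFunction]
    simp only [mul_assoc, ← Finset.mul_sum]
    ring
  have h3 := ZMod.LFunction_one_sub (fun j => θ j) (s := 1)
    (by
      intro n h
      have := congrArg Complex.re h
      simp at this
      have hn : (0 : ℝ) ≤ n := Nat.cast_nonneg n
      linarith)
    (Or.inl (θ.map_zero' (by omega)))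
  rw [h1, h2, hlin, hlin, sub_self, h0] at h3
  have e1 : Complex.exp (π * Complex.I * 1 / 2) = Complex.I := by
    rw [show (π * Complex.I * 1 / 2 : ℂ) = π / 2 * Complex.I by ring, Complex.exp_pi_div_two_mul_I]
  have e2 : Complex.exp (-π * Complex.I * 1 / 2) = -Complex.I := by
    rw [show (-π * Complex.I * 1 / 2 : ℂ) = -π / 2 * Complex.I by ring, Complex.exp_neg_pi_div_two_mul_I]
  have hpi : (π : ℂ) ≠ 0 := by exact_mod_cast Real.pi_ne_zero
  rw [e1, e2, Complex.Gamma_one, Complex.cpow_zero, Complex.cpow_neg_one] at h3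
  rw [← neg_neg (B1 _ _), h3]
  field_simp
  ring

lemma aux_quad (m : ℕ) [NeZero m] (hmprime : m.Prime) (hm4 : m % 4 = 3)
    (χm : DirichletCharacter ℂ m) (hχm : χm ≠ 1) (hχm2 : χm ^ 2 = 1) : χm (-1) = -1 := by
  haveI : Fact m.Prime := ⟨hmprime⟩
  have hsq : χm (-1) ^ 2 = 1 := by rw [← map_pow]; simp
  have hsq' : (χm (-1) - 1) * (χm (-1) + 1) = 0 := by linear_combination hsq
  rcases mul_eq_zero.1 hsq' with h | h
  · exfalso
    apply hχm
    replace h := sub_eq_zero.1 h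
    have hs : ∀ a : ZMod m, a ≠ 0 → IsSquare a → χm a = 1 := by
      rintro a ha ⟨b, rfl⟩
      have hb : IsUnit b := by
        rw [isUnit_iff_ne_zero]; rintro rfl; simp at ha
      rw [map_mul, ← sq]
      have := congrArg (fun c : DirichletCharacter ℂ m => c b) hχm2
      simpa [MulChar.pow_apply' _ two_ne_zero, MulChar.one_apply hb] using this
    have hm2 : ringChar (ZMod m) ≠ 2 := by
      rw [ZMod.ringChar_zmod_n]; omega
    have hneg : ¬ IsSquare (-1 : ZMod m) := by
      rw [ZMod.exists_sq_eq_neg_one_iff]; simpa using hm4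
    refine MulChar.ext fun a => ?_
    rw [MulChar.one_apply_coe]
    have ha : (a : ZMod m) ≠ 0 := a.ne_zero
    by_cases hsa : IsSquare (a : ZMod m)
    · exact hs _ ha hsa
    · have h1 : quadraticChar (ZMod m) a = -1 := quadraticChar_neg_one_iff_not_isSquare.2 hsa
      have h2 : quadraticChar (ZMod m) (-1) = -1 := quadraticChar_neg_one_iff_not_isSquare.2 hneg
      have h3 : quadraticChar (ZMod m) (-1 * a) = 1 := by rw [map_mul, h1, h2]; norm_num
      have h4 := hs (-1 * a) (by simpa using ha) ((quadraticChar_one_iff_isSquare (by simpa using ha)).1 h3)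
      rwa [map_mul, h, one_mul] at h4
  · exact eq_neg_of_add_eq_zero_left h

lemma aux_final (P1 P2 L1 B cD gχ gφi gφ x1 x2 y1 y2 w F p : ℂ) (hF : F ≠ 0)
    (c1 : x1 * x2 = 1) (c2 : y1 * y2 = 1) (hG : gφ * (w * gφi) = F) :
    1 / 2 * (gχ / (2 * p * Complex.I) * cD * P1 * P2 * L1 * (-B)) =
      (w * y1 * gφ / F) * (x1 * cD) * P1 * P2 *
        ((Complex.I / p * (x2 * y2 * gχ * gφi) * L1) / 2) * (B / 2) := by
  have h1 : gχ / (2 * p * Complex.I) = -(gχ * Complex.I * p⁻¹ / 2) := by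
    rw [div_eq_mul_inv, mul_inv, mul_inv, Complex.inv_I]; ring
  have h2 : (gφ * (w * gφi)) * F⁻¹ = 1 := by rw [hG, mul_inv_cancel₀ hF]
  rw [h1]
  calc _ = (gχ * Complex.I * cD * P1 * P2 * L1 * B) * p⁻¹ / 4 := by ring
    _ = (gχ * Complex.I * cD * P1 * P2 * L1 * B) * p⁻¹ / 4 *
        ((x1 * x2) * (y1 * y2) * ((gφ * (w * gφi)) * F⁻¹)) := by
        rw [c1, c2, h2]; ring
    _ = _ := by ring

/-- If moreover `m ≡ 3 (mod 4)` is prime, `χ` is not quadratic, and `χ(−1) = −φ(−1)`, then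
with `χ_m` the quadratic character mod `m`, for both signs
`Λ_±(E_{φ,M,L}, χ, 1) := (1/2)[Λ(E_{φ,M,L}, χ, 1) ± Λ(E_{φ,M,L}, χχ_m, 1)]`
equals `(φ(−m)τ(φ)/f)·χ(fD)·∏_{l∣T₁}(1 − χφ(l)/l)·∏_{q∣T₂}(1 − χφ⁻¹(q))
·(B₁(χ⁻¹φ⁻¹)/2)·(B₁(χφ⁻¹)/2)`. -/
theorem LambdaVal_pm_eq
    (f : ℕ) [NeZero f] (hf : 1 < f) (φ : DirichletCharacter ℂ f)
    (hφ : φ ≠ 1) (hφprim : φ.IsPrimitive)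
    (N M L : ℕ) (hN : 0 < N) (hM : 0 < M) (hL : 0 < L)
    (hdvd : f ^ 2 * M * L ∣ N) (hcop : Nat.Coprime (f * M) L)
    (T₁ T₂ D : ℕ)
    (hT₁ : T₁ = ∏ l ∈ M.primeFactors.filter (fun l => ¬ l ∣ f), l)
    (hT₂ : T₂ = ∏ q ∈ L.primeFactors, q)
    (hD : D = M * L / (T₁ * T₂))
    (m : ℕ) [NeZero m] (χ : DirichletCharacter ℂ m)
    (hχ : χ ≠ 1) (hχprim : χ.IsPrimitive) (hm : Nat.Coprime m N)
    (hmprime : m.Prime) (hm4 : m % 4 = 3)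
    (hχnotquad : χ ^ 2 ≠ 1)
    (hχodd : χ (-1 : ZMod m) = - φ (-1 : ZMod f))
    (χm : DirichletCharacter ℂ m) (hχm : χm ≠ 1) (hχm2 : χm ^ 2 = 1) :
    (1 / 2 : ℂ) * (LambdaVal f m φ χ T₁ T₂ D + LambdaVal f m φ (χ * χm) T₁ T₂ D) =
      (φ (-((m : ℕ) : ZMod f)) * gaussSum' f φ / (f : ℂ)) * χ ((f * D : ℕ) : ZMod m) *
        (∏ l ∈ T₁.primeFactors,
          (1 - χ ((l : ℕ) : ZMod m) * φ ((l : ℕ) : ZMod f) / (l : ℂ))) *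
        (∏ q ∈ T₂.primeFactors,
          (1 - χ ((q : ℕ) : ZMod m) * φ⁻¹ ((q : ℕ) : ZMod f))) *
        (B1 (f * m) (prodChar m f χ⁻¹ φ⁻¹) / 2) * (B1 (f * m) (prodChar m f χ φ⁻¹) / 2) ∧
    (1 / 2 : ℂ) * (LambdaVal f m φ χ T₁ T₂ D - LambdaVal f m φ (χ * χm) T₁ T₂ D) =
      (φ (-((m : ℕ) : ZMod f)) * gaussSum' f φ / (f : ℂ)) * χ ((f * D : ℕ) : ZMod m) *
        (∏ l ∈ T₁.primeFactors,
          (1 - χ ((l : ℕ) : ZMod m) * φ ((l : ℕ) : ZMod f) / (l : ℂ))) *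
        (∏ q ∈ T₂.primeFactors,
          (1 - χ ((q : ℕ) : ZMod m) * φ⁻¹ ((q : ℕ) : ZMod f))) *
        (B1 (f * m) (prodChar m f χ⁻¹ φ⁻¹) / 2) * (B1 (f * m) (prodChar m f χ φ⁻¹) / 2) := by
  have hfm : Nat.Coprime f m := by
    refine (hm.coprime_dvd_right (Dvd.dvd.trans ?_ hdvd)).symm
    exact ⟨f * M * L, by ring⟩
  have hm1 : 1 < m := hmprime.one_lt
  have hfm1 : 1 < f * m := by nlinarith
  haveI : Fact m.Prime := ⟨hmprime⟩
  have hqm := aux_quad m hmprime hm4 χm hχm hχm2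
  have hφsq : φ (-1) * φ (-1) = 1 := by rw [← map_mul]; simp
  have hφi : φ⁻¹ (-1) = φ (-1) := by
    rw [MulChar.inv_apply_eq_inv']
    exact inv_eq_of_mul_eq_one_right hφsq
  have hχi : χ⁻¹ (-1) = χ (-1) := by
    rw [MulChar.inv_apply_eq_inv']
    exact inv_eq_of_mul_eq_one_right (by rw [← map_mul]; simp)
  have hodd1 : (prodChar m f χ φ⁻¹).Odd := by
    rw [DirichletCharacter.Odd, aux_prod_apply]
    simp only [map_neg, map_one, hφi, hχodd]
    linear_combination -hφsq
  have hodd2 : (prodChar m f χ⁻¹ φ⁻¹).Odd := by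
    rw [DirichletCharacter.Odd, aux_prod_apply]
    simp only [map_neg, map_one, hφi, hχi, hχodd]
    linear_combination -hφsq
  have heven : (prodChar m f (χ * χm) φ⁻¹).Even := by
    rw [DirichletCharacter.Even, aux_prod_apply]
    simp only [map_neg, map_one, hφi, MulChar.mul_apply, hχodd, hqm]
    linear_combination hφsq
  have hzero : LambdaVal f m φ (χ * χm) T₁ T₂ D = 0 := by
    have h : (prodChar m f (χ * χm) φ⁻¹).LFunction 0 = 0 := by
      rw [DirichletCharacter.LFunction, ZMod.LFunction_apply_zero_of_even heven.to_fun,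
        DirichletCharacter.map_zero' _ (by omega)]
      simp
    rw [LambdaVal, h, mul_zero]
  rw [hzero, add_zero, sub_zero, and_self]
  have hL0 : (prodChar m f χ φ⁻¹).LFunction 0 = - B1 (f * m) (prodChar m f χ φ⁻¹) :=
    aux_L_zero (f * m) hfm1 _ hodd1
  have hB := aux_L_one m f hfm1 hfm χ φ hχprim hφprim hodd2
  have hG := aux_gauss_mul f φ hφprim
  rw [LambdaVal, hL0, hB, aux_gauss, aux_gauss]
  have c1 : χ (f : ZMod m) * χ⁻¹ (f : ZMod m) = 1 := by
    rw [← MulChar.mul_apply, mul_inv_cancel, MulChar.one_apply]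
    exact (ZMod.isUnit_iff_coprime _ _).2 hfm
  have c2 : φ (m : ZMod f) * φ⁻¹ (m : ZMod f) = 1 := by
    rw [← MulChar.mul_apply, mul_inv_cancel, MulChar.one_apply]
    exact (ZMod.isUnit_iff_coprime _ _).2 hfm.symm
  have c3 : φ (-(m : ZMod f)) = φ (-1) * φ (m : ZMod f) := by
    rw [← map_mul]; simp
  have c4 : χ ((f * D : ℕ) : ZMod m) = χ (f : ZMod m) * χ (D : ZMod m) := by
    rw [← map_mul]; simp
  have hf0 : (f : ℂ) ≠ 0 := NeZero.ne _
  rw [c3, c4]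
  exact aux_final _ _ _ _ _ _ _ _ _ _ _ _ _ _ _ hf0 c1 c2 hG
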